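/- Let S be an inverse semigroup and let N be a closed normal inverse subsemigroup of S. Then for all s, t ∈ S: (i) s ≃_N t implies s t⁻¹ ∈ N; and (ii) s t⁻¹ ∈ N if and only if s t⁻¹ t ≃_N t s⁻¹ s. -/

import Mathlib

/-- An inverse semigroup: a semigroup in which every element `s` has a
(unique) inverse `s⁻¹` with `s * s⁻¹ * s = s` and `s⁻¹ * s * s⁻¹ = s⁻¹`. -/
class InverseSemigroup (S : Type*) extends Semigroup S, Inv S where
  mul_inv_mul : ∀ s : S, s * s⁻¹ * s = s
  inv_mul_inv : ∀ s : S, s⁻¹ * s * s⁻¹ = s⁻¹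
  inv_unique : ∀ s t : S, s * t * s = s → t * s * t = t → t = s⁻¹

/-- The natural partial order on an inverse semigroup:
`s ≤ t` iff `s = e * t` for some idempotent `e`. -/
def NatLe {S : Type*} [InverseSemigroup S] (s t : S) : Prop :=
  ∃ e : S, IsIdempotentElem e ∧ s = e * t

/-- A normal inverse subsemigroup: a full inverse subsemigroup that is
closed under conjugation. -/
structure IsNormalInverseSubsemigroup {S : Type*} [InverseSemigroup S] (N : Set S) : Prop where
  mul_mem : ∀ {a b : S}, a ∈ N → b ∈ N → a * b ∈ N
  inv_mem : ∀ {a : S}, a ∈ N → a⁻¹ ∈ N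
  full : ∀ {e : S}, IsIdempotentElem e → e ∈ N
  conj_mem : ∀ (s : S) {n : S}, n ∈ N → s⁻¹ * n * s ∈ N

/-- The preorder `≤_N` associated to a normal inverse subsemigroup `N`:
`s ≤_N t` iff there are `a, b ∈ N` with `a⁻¹ * a = s * s⁻¹`,
`s⁻¹ * s = b * b⁻¹` (so `a · s · b` is a trace product) and `a * s * b ≤ t`. -/
def LeN {S : Type*} [InverseSemigroup S] (N : Set S) (s t : S) : Prop :=
  ∃ a ∈ N, ∃ b ∈ N, a⁻¹ * a = s * s⁻¹ ∧ s⁻¹ * s = b * b⁻¹ ∧ NatLe (a * s * b) t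

/-- The equivalence `≃_N` obtained by symmetrizing `≤_N`. -/
def SimeqN {S : Type*} [InverseSemigroup S] (N : Set S) (s t : S) : Prop :=
  LeN N s t ∧ LeN N t s

namespace InverseSemigroup

variable {S : Type*} [InverseSemigroup S]

theorem mul_inv_mul_cancel_left (s x : S) : s * (s⁻¹ * (s * x)) = s * x := by
  rw [← mul_assoc, ← mul_assoc, mul_inv_mul]

theorem inv_mul_inv_cancel_left (s x : S) : s⁻¹ * (s * (s⁻¹ * x)) = s⁻¹ * x := by
  rw [← mul_assoc, ← mul_assoc, inv_mul_inv]

theorem mul_inv_mul' (s : S) : s * (s⁻¹ * s) = s := by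
  rw [← mul_assoc, mul_inv_mul]

theorem inv_mul_inv' (s : S) : s⁻¹ * (s * s⁻¹) = s⁻¹ := by
  rw [← mul_assoc, inv_mul_inv]

protected theorem inv_inv (s : S) : s⁻¹⁻¹ = s :=
  (inv_unique s⁻¹ s (inv_mul_inv s) (mul_inv_mul s)).symm

theorem isIdempotentElem_mul_inv (s : S) : IsIdempotentElem (s * s⁻¹) := by
  simp only [IsIdempotentElem, mul_assoc, inv_mul_inv']

theorem isIdempotentElem_inv_mul (s : S) : IsIdempotentElem (s⁻¹ * s) := by
  simp only [IsIdempotentElem, mul_assoc, mul_inv_mul']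

theorem inv_eq_self {e : S} (he : IsIdempotentElem e) : e⁻¹ = e :=
  (inv_unique e e (by rw [he.eq, he.eq]) (by rw [he.eq, he.eq])).symm

theorem isIdempotentElem_mul {e f : S} (he : IsIdempotentElem e) (hf : IsIdempotentElem f) :
    IsIdempotentElem (e * f) := by
  have he' : ∀ x, e * (e * x) = e * x := fun x => by rw [← mul_assoc, he.eq]
  have hf' : ∀ x, f * (f * x) = f * x := fun x => by rw [← mul_assoc, hf.eq]
  set x := (e * f)⁻¹ with hx
  have h1 : e * (f * (x * (e * f))) = e * f := by
    simpa only [mul_assoc] using mul_inv_mul (e * f)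
  have h2 : x * (e * (f * x)) = x := by
    simpa only [mul_assoc] using inv_mul_inv (e * f)
  have h2' : ∀ y, x * (e * (f * (x * y))) = x * y := fun y => by
    simpa only [mul_assoc] using congrArg (· * y) h2
  have h3 : f * (x * e) = x := by
    apply inv_unique (e * f)
    · simp only [mul_assoc, he', hf', h1]
    · simp only [mul_assoc, he', hf', h2']
  have h4 : IsIdempotentElem x := by
    calc x * x = f * (x * e) * (f * (x * e)) := by rw [h3]
      _ = f * (x * e) := by simp only [mul_assoc, h2']
      _ = x := h3
  have h5 : e * f = x := by
    rw [← inv_eq_self h4, hx, InverseSemigroup.inv_inv]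
  rwa [h5]

theorem commute_of_isIdempotentElem {e f : S} (he : IsIdempotentElem e)
    (hf : IsIdempotentElem f) : e * f = f * e := by
  have he' : ∀ x, e * (e * x) = e * x := fun x => by rw [← mul_assoc, he.eq]
  have hf' : ∀ x, f * (f * x) = f * x := fun x => by rw [← mul_assoc, hf.eq]
  have hef := isIdempotentElem_mul he hf
  have hfe := isIdempotentElem_mul hf he
  rw [← inv_eq_self hef]
  symm
  apply inv_unique
  · simpa only [mul_assoc, he', hf'] using hef.eq
  · simpa only [mul_assoc, he', hf'] using hfe.eq

theorem inv_mul_comm (s t : S) : s⁻¹ * (s * (t⁻¹ * t)) = t⁻¹ * (t * (s⁻¹ * s)) := by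
  simpa only [mul_assoc] using
    commute_of_isIdempotentElem (isIdempotentElem_inv_mul s) (isIdempotentElem_inv_mul t)

theorem inv_mul_mul_inv_comm (s t : S) : s⁻¹ * (s * (t * t⁻¹)) = t * (t⁻¹ * (s⁻¹ * s)) := by
  simpa only [mul_assoc] using
    commute_of_isIdempotentElem (isIdempotentElem_inv_mul s) (isIdempotentElem_mul_inv t)

protected theorem mul_inv_rev (s t : S) : (s * t)⁻¹ = t⁻¹ * s⁻¹ := by
  have h : ∀ x, s⁻¹ * (s * (t * (t⁻¹ * x))) = t * (t⁻¹ * (s⁻¹ * (s * x))) := fun x => by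
    simpa only [mul_assoc] using congrArg (· * x) (inv_mul_mul_inv_comm s t)
  symm
  apply inv_unique
  · simp only [mul_assoc]
    rw [← h, mul_inv_mul_cancel_left, mul_inv_mul']
  · simp only [mul_assoc]
    rw [h, inv_mul_inv', inv_mul_inv_cancel_left]

end InverseSemigroup

open InverseSemigroup

theorem NatLe.refl {S : Type*} [InverseSemigroup S] (s : S) : NatLe s s :=
  ⟨s * s⁻¹, isIdempotentElem_mul_inv s, (mul_inv_mul s).symm⟩

theorem NatLe.mul_inv_left {S : Type*} [InverseSemigroup S] {u t : S} (h : NatLe u t) (x : S) :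
    NatLe (x * u⁻¹) (x * t⁻¹) := by
  obtain ⟨e, he, rfl⟩ := h
  rw [InverseSemigroup.mul_inv_rev, inv_eq_self he, ← mul_assoc]
  set w := x * t⁻¹
  have hcomm := commute_of_isIdempotentElem he (isIdempotentElem_inv_mul w)
  refine ⟨w * e * w⁻¹, ?_, ?_⟩
  · calc w * e * w⁻¹ * (w * e * w⁻¹) = w * (e * (w⁻¹ * w)) * e * w⁻¹ := by
          simp only [mul_assoc]
      _ = w * w⁻¹ * w * (e * e) * w⁻¹ := by rw [hcomm]; simp only [mul_assoc]
      _ = w * e * w⁻¹ := by rw [mul_inv_mul, he.eq]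
  · calc w * e = w * (w⁻¹ * w * e) := by rw [← mul_assoc, mul_inv_mul']
      _ = w * e * w⁻¹ * w := by rw [← hcomm]; simp only [mul_assoc]

theorem LeN.mul_inv_mem {S : Type*} [InverseSemigroup S] {N : Set S}
    (hN : IsNormalInverseSubsemigroup N)
    (hclosed : ∀ n s : S, n ∈ N → NatLe n s → s ∈ N) {s t : S} (h : LeN N s t) :
    s * t⁻¹ ∈ N := by
  obtain ⟨a, ha, b, hb, -, -, hle⟩ := h
  refine hclosed _ _ ?_ (hle.mul_inv_left s)
  have hconj := hN.conj_mem s⁻¹ (hN.inv_mem hb)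
  rw [InverseSemigroup.inv_inv] at hconj
  simpa only [InverseSemigroup.mul_inv_rev, mul_assoc] using hN.mul_mem hconj (hN.inv_mem ha)

theorem IsNormalInverseSubsemigroup.leN_of_mul_inv_mem {S : Type*} [InverseSemigroup S]
    {N : Set S} (hN : IsNormalInverseSubsemigroup N) {s t : S} (h : s * t⁻¹ ∈ N) :
    LeN N (s * t⁻¹ * t) (t * s⁻¹ * s) := by
  refine ⟨_, hN.inv_mem h, _,
    hN.full (isIdempotentElem_inv_mul (s * t⁻¹ * t)), ?_, ?_, ?_⟩
  · simp only [InverseSemigroup.mul_inv_rev, InverseSemigroup.inv_inv, mul_assoc,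
      inv_mul_inv_cancel_left]
  · rw [inv_eq_self (isIdempotentElem_inv_mul _), (isIdempotentElem_inv_mul _).eq]
  · have hprod : (s * t⁻¹)⁻¹ * (s * t⁻¹ * t) * ((s * t⁻¹ * t)⁻¹ * (s * t⁻¹ * t)) =
        t * s⁻¹ * s := by
      rw [mul_assoc, mul_inv_mul']
      simp only [InverseSemigroup.mul_inv_rev, InverseSemigroup.inv_inv, mul_assoc]
      rw [inv_mul_comm, mul_inv_mul_cancel_left]
    rw [hprod]
    exact NatLe.refl _

/-- For a closed normal inverse subsemigroup `N`: `s ≃_N t` implies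
`s t⁻¹ ∈ N`, and `s t⁻¹ ∈ N` iff `s t⁻¹ t ≃_N t s⁻¹ s`. -/
theorem closed_normal_simeqN_cosets {S : Type*} [InverseSemigroup S] {N : Set S}
    (hN : IsNormalInverseSubsemigroup N)
    (hclosed : ∀ n s : S, n ∈ N → NatLe n s → s ∈ N) :
    ∀ s t : S,
      (SimeqN N s t → s * t⁻¹ ∈ N) ∧
      (s * t⁻¹ ∈ N ↔ SimeqN N (s * t⁻¹ * t) (t * s⁻¹ * s)) := by
  intro s t
  refine ⟨fun h => h.1.mul_inv_mem hN hclosed, fun h => ?_, fun h => ?_⟩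
  · refine ⟨hN.leN_of_mul_inv_mem h, hN.leN_of_mul_inv_mem ?_⟩
    simpa only [InverseSemigroup.mul_inv_rev, InverseSemigroup.inv_inv] using hN.inv_mem h
  · have hmem := h.1.mul_inv_mem hN hclosed
    have hprod : s * t⁻¹ * t * (t * s⁻¹ * s)⁻¹ = s * t⁻¹ := by
      have hcomm := congrArg (· * t⁻¹) (inv_mul_comm t s)
      simp only [mul_assoc] at hcomm
      simp only [InverseSemigroup.mul_inv_rev, InverseSemigroup.inv_inv, mul_assoc]
      rw [hcomm, mul_inv_mul_cancel_left, inv_mul_inv']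
    rwa [hprod] at hmem
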